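/- There exist constants c, C > 0 depending only on g and M such that for every real λ > 1 there is a threshold n₀ with the following property: for every integer n ≥ n₀ one has c · λ^{2g+2} log n ≤ ∑_{ω ∈ R_n} ∏_{y ∈ ω} λ^{-1} y^{-α} ≤ C · λ^{2g+2} log n (the product being over the three elements of the 3-element set ω, so each summand equals λ^{-3}(x₁x₂x₃)^{-α} for ω = {x₁,x₂,x₃}). -/

import Mathlib

noncomputable section

open Real MeasureTheory ProbabilityTheory

def IsSidonZ {M : ℕ} (S : Set (ZMod M)) : Prop :=
  ∀ a ∈ S, ∀ b ∈ S, ∀ c ∈ S, ∀ d ∈ S, a + b = c + d → ({a, b} : Set (ZMod M)) = {c, d}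

def Covers3 {M : ℕ} (S : Set (ZMod M)) : Prop :=
  ∀ z : ZMod M, ∃ s₁ ∈ S, ∃ s₂ ∈ S, ∃ s₃ ∈ S,
    s₁ ≠ s₂ ∧ s₁ ≠ s₃ ∧ s₂ ≠ s₃ ∧ z = s₁ + s₂ + s₃

def alph (g : ℕ) : ℝ := ((g : ℝ) + 1) / (2 * (g : ℝ) + 1)

def glam (g : ℕ) (lam : ℝ) (n : ℕ) : ℝ :=
  lam ^ ((2 * (g : ℝ) + 5) / (1 - alph g)) * (n : ℝ) ^ ((1 : ℝ) / (g : ℝ)) *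
    Real.log n ^ ((1 : ℝ) / (1 - alph g))

def GoodS (M : ℕ) (CM : Set (ZMod M)) (s : ℕ → Fin 3 → ZMod M) : Prop :=
  ∀ n : ℕ, (∀ i, s n i ∈ CM) ∧ s n 0 ≠ s n 1 ∧ s n 0 ≠ s n 2 ∧ s n 1 ≠ s n 2 ∧
    s n 0 + s n 1 + s n 2 = (n : ZMod M)

def Rtrip (g M : ℕ) (lam : ℝ) (s : ℕ → Fin 3 → ZMod M) (n x₁ x₂ x₃ : ℕ) : Prop :=
  0 < x₁ ∧ 0 < x₂ ∧ 0 < x₃ ∧ x₁ + x₂ + x₃ = n ∧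
  glam g lam n / 2 ≤ (x₁ : ℝ) ∧ (x₁ : ℝ) ≤ glam g lam n ∧
  (n : ℝ) / 4 ≤ (x₂ : ℝ) ∧ x₂ ≤ n ∧ (n : ℝ) / 4 ≤ (x₃ : ℝ) ∧ x₃ ≤ n ∧
  (x₁ : ZMod M) = s n 0 ∧ (x₂ : ZMod M) = s n 1 ∧ (x₃ : ZMod M) = s n 2

def Rn (g M : ℕ) (lam : ℝ) (s : ℕ → Fin 3 → ZMod M) (n : ℕ) : Set (Finset ℕ) :=
  {ω | ∃ x₁ x₂ x₃ : ℕ, ω = {x₁, x₂, x₃} ∧ Rtrip g M lam s n x₁ x₂ x₃}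

def imgF {m : ℕ} (x : Fin m → ℕ) : Finset ℕ := Finset.image x Finset.univ

def firstThree (g : ℕ) (x : Fin (2 * g + 4) → ℕ) : Finset ℕ :=
  {x ⟨0, by omega⟩, x ⟨1, by omega⟩, x ⟨2, by omega⟩}

def pairOf (g : ℕ) (x : Fin (2 * g + 4) → ℕ) (j : ℕ) : Finset ℕ :=
  if j = 0 then {x ⟨0, by omega⟩, x ⟨3, by omega⟩}
  else if h : j ≤ g then {x ⟨2 * j + 2, by omega⟩, x ⟨2 * j + 3, by omega⟩}
  else ∅

def Tn (g M : ℕ) (lam : ℝ) (s : ℕ → Fin 3 → ZMod M) (n : ℕ) :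
    Set (Fin (2 * g + 4) → ℕ) :=
  {x | (∀ i, 0 < x i) ∧
    firstThree g x ∈ Rn g M lam s n ∧
    (∀ j : ℕ, 2 ≤ j → ∀ _ : j ≤ g + 1,
      x ⟨0, by omega⟩ + x ⟨3, by omega⟩ = x ⟨2 * j, by omega⟩ + x ⟨2 * j + 1, by omega⟩) ∧
    (∀ i : Fin (2 * g + 4), 3 ≤ (i : ℕ) → x i ≤ x ⟨0, by omega⟩) ∧
    (∀ k : ℕ, 2 ≤ k → ∀ _ : k ≤ g + 1,
      (x ⟨2 * k, by omega⟩ : ZMod M) = (x ⟨0, by omega⟩ : ZMod M) ∧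
      (x ⟨2 * k + 1, by omega⟩ : ZMod M) = (x ⟨3, by omega⟩ : ZMod M)) ∧
    (∀ j k : ℕ, j ≤ g → k ≤ g → j ≠ k → pairOf g x j ≠ pairOf g x k)}

def TnInd (g M : ℕ) (lam : ℝ) (s : ℕ → Fin 3 → ZMod M) (n : ℕ) :
    Set (Fin (2 * g + 4) → ℕ) :=
  {x ∈ Tn g M lam s n | Function.Injective x}

def TnDep (g M : ℕ) (lam : ℝ) (s : ℕ → Fin 3 → ZMod M) (n : ℕ) :
    Set (Fin (2 * g + 4) → ℕ) :=
  {x ∈ Tn g M lam s n | ¬ Function.Injective x}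

def Vr (g : ℕ) (r₁ : ℕ) : Set (Fin (2 * g + 1) → ℕ) :=
  {v | (∀ i, 0 < v i) ∧
    (∀ t : ℕ, ∀ _ : t < g,
      r₁ + v ⟨0, by omega⟩ = v ⟨2 * t + 1, by omega⟩ + v ⟨2 * t + 2, by omega⟩) ∧
    (∀ i, v i ≤ r₁) ∧ Function.Injective v ∧ (∀ i, v i ≠ r₁)}

def Tcal (X r : Finset ℕ) (k : ℕ) (eps : ℕ → ℤ) : Set (ℕ → ℕ) :=
  {y | (∀ j < k, y j ∈ X ∪ r) ∧ (∀ j, k ≤ j → y j = 0) ∧ (∃ j < k, y j ∈ X) ∧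
    (∀ i < k, ∀ j < k, y i = y j → eps i = eps j)}

def Fval (k : ℕ) (eps : ℕ → ℤ) (y : ℕ → ℕ) : ℤ :=
  ∑ j ∈ Finset.range k, eps j * (y j : ℤ)

def Ccal (U X r : Finset ℕ) : Set (Finset ℕ) :=
  {w | w.card = 4 ∧ w ⊆ U ∧ (∃ a ∈ w, a ∈ X ∧ a ∉ r) ∧
    ∃ y₁ y₂ y₃ y₄ : ℕ, w = {y₁, y₂, y₃, y₄} ∧ y₁ + y₂ = y₃ + y₄ ∧
      ({y₁, y₂} : Finset ℕ) ≠ {y₃, y₄}}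

def CcalR (g M : ℕ) (lam : ℝ) (s : ℕ → Fin 3 → ZMod M) (n : ℕ) (X r : Finset ℕ) :
    Set (Finset ℕ) :=
  {w | w ∈ Rn g M lam s n ∧ w ⊆ X ∪ r ∧ ∃ a ∈ w, a ∈ X ∧ a ∉ r}

def Sx (g : ℕ) (x : Fin (2 * g + 4) → ℕ) : Set (Finset ℕ) :=
  {w | ∃ l : ℕ, ∃ _ : 3 ≤ l, ∃ _ : l ≤ g + 2,
      w = ({x ⟨0, by omega⟩, x ⟨3, by omega⟩,
            x ⟨2 * l - 2, by omega⟩, x ⟨2 * l - 1, by omega⟩} : Finset ℕ)} ∪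
  {w | ∃ l j : ℕ, ∃ _ : 3 ≤ l, ∃ _ : l < j, ∃ _ : j ≤ g + 2,
      w = ({x ⟨2 * j - 2, by omega⟩, x ⟨2 * j - 1, by omega⟩,
            x ⟨2 * l - 2, by omega⟩, x ⟨2 * l - 1, by omega⟩} : Finset ℕ)}

def SxV (g : ℕ) (r₁ : ℕ) (v : Fin (2 * g + 1) → ℕ) : Set (Finset ℕ) :=
  {w | ∃ l : ℕ, ∃ _ : 3 ≤ l, ∃ _ : l ≤ g + 2,
      w = ({r₁, v ⟨0, by omega⟩, v ⟨2 * l - 5, by omega⟩, v ⟨2 * l - 4, by omega⟩} : Finset ℕ)} ∪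
  {w | ∃ l j : ℕ, ∃ _ : 3 ≤ l, ∃ _ : l < j, ∃ _ : j ≤ g + 2,
      w = ({v ⟨2 * j - 5, by omega⟩, v ⟨2 * j - 4, by omega⟩,
            v ⟨2 * l - 5, by omega⟩, v ⟨2 * l - 4, by omega⟩} : Finset ℕ)}

def tailSet (g : ℕ) (x : Fin (2 * g + 4) → ℕ) : Finset ℕ :=
  Finset.image (fun i : Fin (2 * g + 1) => x ⟨(i : ℕ) + 3, by have := i.isLt; omega⟩)
    Finset.univ

/-- An interval of length at least `2 * M` contains many members of each residue class mod `M`. -/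
lemma exists_finset_residue_class (M : ℕ) (hM : 1 ≤ M) (z : ZMod M) (a b : ℝ) (ha : 0 ≤ a)
    (hab : 2 * (M : ℝ) ≤ b - a) :
    ∃ A : Finset ℕ, (∀ x ∈ A, a ≤ (x : ℝ) ∧ (x : ℝ) ≤ b ∧ (x : ZMod M) = z) ∧
      (b - a) / (2 * M) ≤ (A.card : ℝ) := by
  have : NeZero M := ⟨by omega⟩
  have hM0 : (0 : ℝ) < M := by exact_mod_cast hM
  set r := (z - ((⌈a⌉₊ : ℕ) : ZMod M)).val with hr
  set K := ⌊(b - a) / M⌋₊ with hK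
  have hdiv : (2 : ℝ) ≤ (b - a) / M := by rwa [le_div_iff₀ hM0]
  have hKle : (K : ℝ) * M ≤ b - a := by
    rw [← le_div_iff₀ hM0]; exact Nat.floor_le (by linarith)
  have hKlt : (b - a) / M < K + 1 := Nat.lt_floor_add_one _
  have hrM : (r : ℝ) + 1 ≤ M := by
    have : r < M := ZMod.val_lt _
    exact_mod_cast this
  refine ⟨(Finset.range K).image fun k => ⌈a⌉₊ + r + M * k, ?_, ?_⟩
  · intro x hx
    obtain ⟨k, hk, rfl⟩ := Finset.mem_image.1 hx
    have hk' : (k : ℝ) + 1 ≤ K := by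
      have := Finset.mem_range.1 hk
      exact_mod_cast this
    have h1 : a ≤ ⌈a⌉₊ := Nat.le_ceil a
    have h2 : (⌈a⌉₊ : ℝ) < a + 1 := Nat.ceil_lt_add_one ha
    have h3 : (M : ℝ) * (k + 1) ≤ M * K := by gcongr
    refine ⟨?_, ?_, ?_⟩
    · push_cast
      have : (0 : ℝ) ≤ r + M * k := by positivity
      linarith
    · push_cast; linarith
    · push_cast
      rw [hr, ZMod.natCast_zmod_val]
      simp
  · rw [Finset.card_image_of_injective, Finset.card_range]
    · have : (b - a) / (2 * M) = (b - a) / M / 2 := by field_simp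
      rw [this]; linarith
    · intro k l hkl
      have : M * k = M * l := by simpa using hkl
      exact Nat.eq_of_mul_eq_mul_left (by omega) this

lemma alph_pos (g : ℕ) : 0 < alph g := by unfold alph; positivity

lemma alph_le_one (g : ℕ) : alph g ≤ 1 := by
  unfold alph
  rw [div_le_one (by positivity)]
  have : (0 : ℝ) ≤ g := by positivity
  linarith

lemma one_sub_alph (g : ℕ) : 1 - alph g = g / (2 * g + 1) := by
  unfold alph
  have : (2 * (g : ℝ) + 1) ≠ 0 := by positivity
  field_simp
  ring

lemma glam_rpow_one_sub_alph (g : ℕ) (hg : 2 ≤ g) (lam : ℝ) (hlam : 1 < lam) (n : ℕ)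
    (hn : 1 ≤ n) :
    glam g lam n ^ (1 - alph g) =
      lam ^ (2 * (g : ℝ) + 5) * (n : ℝ) ^ ((1 : ℝ) / (2 * g + 1)) * Real.log n := by
  have hg0 : (0 : ℝ) < g := by positivity
  have hb : 1 - alph g ≠ 0 := by rw [one_sub_alph]; positivity
  have hlog : 0 ≤ Real.log n := Real.log_natCast_nonneg n
  have hlam0 : 0 ≤ lam := by linarith
  unfold glam
  rw [Real.mul_rpow (by positivity) (by positivity), Real.mul_rpow (by positivity) (by positivity),
    ← Real.rpow_mul hlam0, ← Real.rpow_mul (by positivity), ← Real.rpow_mul hlog,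
    div_mul_cancel₀ _ hb, div_mul_cancel₀ _ hb, Real.rpow_one, one_sub_alph]
  congr 3
  field_simp

lemma main_term_eq (g : ℕ) (hg : 2 ≤ g) (lam : ℝ) (hlam : 1 < lam) (n : ℕ) (hn : 1 ≤ n)
    (hG : 0 < glam g lam n) :
    glam g lam n * n * (lam⁻¹ ^ 3 *
        (glam g lam n ^ (-alph g) * ((n : ℝ) ^ (-alph g) * (n : ℝ) ^ (-alph g)))) =
      lam ^ (2 * g + 2) * Real.log n := by
  have hn0 : (0 : ℝ) < n := by exact_mod_cast hn
  have hlam0 : 0 < lam := by linarith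
  have h1 : glam g lam n * glam g lam n ^ (-alph g) = glam g lam n ^ (1 - alph g) := by
    rw [sub_eq_add_neg, Real.rpow_add hG, Real.rpow_one]
  have h2 : (n : ℝ) ^ ((1 : ℝ) / (2 * g + 1)) *
      (n * ((n : ℝ) ^ (-alph g) * (n : ℝ) ^ (-alph g))) = 1 := by
    nth_rewrite 2 [← Real.rpow_one (n : ℝ)]
    rw [← Real.rpow_add hn0, ← Real.rpow_add hn0, ← Real.rpow_add hn0]
    convert Real.rpow_zero (n : ℝ) using 2
    unfold alph
    field_simp
    ring
  have h3 : lam ^ (2 * (g : ℝ) + 5) = lam ^ (2 * g + 2) * lam ^ 3 := by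
    rw [← pow_add, ← Real.rpow_natCast]
    congr 1
    push_cast
    ring
  calc _ = lam⁻¹ ^ 3 * (glam g lam n * glam g lam n ^ (-alph g)) *
        (n * ((n : ℝ) ^ (-alph g) * (n : ℝ) ^ (-alph g))) := by ring
    _ = lam⁻¹ ^ 3 * lam ^ (2 * (g : ℝ) + 5) * Real.log n * ((n : ℝ) ^ ((1 : ℝ) / (2 * g + 1)) *
      (n * ((n : ℝ) ^ (-alph g) * (n : ℝ) ^ (-alph g)))) := by
        rw [h1, glam_rpow_one_sub_alph g hg lam hlam n hn]; ring
    _ = _ := by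
        rw [h2, h3]
        field_simp

lemma tendsto_glam_atTop (g : ℕ) (hg : 2 ≤ g) (lam : ℝ) (hlam : 1 < lam) :
    Filter.Tendsto (glam g lam) Filter.atTop Filter.atTop := by
  have hg0 : (0 : ℝ) < g := by positivity
  have hb : 0 < 1 - alph g := by rw [one_sub_alph]; positivity
  have hlam0 : 0 < lam := by linarith
  have hnat : Filter.Tendsto (fun n : ℕ => (n : ℝ)) Filter.atTop Filter.atTop :=
    tendsto_natCast_atTop_atTop
  unfold glam
  exact (((tendsto_rpow_atTop (by positivity)).comp hnat).const_mul_atTop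
    (Real.rpow_pos_of_pos hlam0 _)).atTop_mul_atTop₀
    ((tendsto_rpow_atTop (by positivity)).comp (Real.tendsto_log_atTop.comp hnat))

lemma eventually_glam_le (g : ℕ) (hg : 2 ≤ g) (lam : ℝ) (hlam : 1 < lam) :
    ∀ᶠ n : ℕ in Filter.atTop, glam g lam n ≤ n / 4 := by
  set K := lam ^ ((2 * (g : ℝ) + 5) / (1 - alph g)) with hK
  have hK0 : 0 < K := Real.rpow_pos_of_pos (by linarith) _
  have hlo := (isLittleO_log_rpow_rpow_atTop ((1 : ℝ) / (1 - alph g))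
    (show (0 : ℝ) < 1 / 2 by norm_num)).bound (show 0 < 1 / (4 * K) by positivity)
  filter_upwards [tendsto_natCast_atTop_atTop.eventually hlo, Filter.eventually_ge_atTop 1]
    with n hn hn1
  have hn1' : (1 : ℝ) ≤ n := by exact_mod_cast hn1
  have hg2 : (2 : ℝ) ≤ g := by exact_mod_cast hg
  have hpow : (n : ℝ) ^ ((1 : ℝ) / g) ≤ (n : ℝ) ^ ((1 : ℝ) / 2) :=
    Real.rpow_le_rpow_of_exponent_le hn1' (by gcongr)
  have hlog : 0 ≤ Real.log n := Real.log_natCast_nonneg n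
  rw [Real.norm_of_nonneg (by positivity), Real.norm_of_nonneg (by positivity)] at hn
  calc glam g lam n ≤ K * (n : ℝ) ^ ((1 : ℝ) / 2) * (1 / (4 * K) * (n : ℝ) ^ ((1 : ℝ) / 2)) := by
        unfold glam; gcongr
    _ = ((n : ℝ) ^ ((1 : ℝ) / 2) * (n : ℝ) ^ ((1 : ℝ) / 2)) / 4 := by field_simp
    _ = n / 4 := by
        rw [← Real.rpow_add (by linarith)]; norm_num

/-- The pairs `(x₁, x₂)` that extend to an admissible triple `(x₁, x₂, n - x₁ - x₂)`. -/
def admissiblePairs (g M : ℕ) (lam : ℝ) (s : ℕ → Fin 3 → ZMod M) (n : ℕ) : Finset (ℕ × ℕ) :=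
  open Classical in
  (Finset.range (⌊glam g lam n⌋₊ + 1) ×ˢ Finset.range (n + 1)).filter fun p =>
    Rtrip g M lam s n p.1 p.2 (n - p.1 - p.2)

lemma mem_admissiblePairs {g M : ℕ} {lam : ℝ} {s : ℕ → Fin 3 → ZMod M} {n : ℕ} {p : ℕ × ℕ} :
    p ∈ admissiblePairs g M lam s n ↔ Rtrip g M lam s n p.1 p.2 (n - p.1 - p.2) := by
  unfold admissiblePairs
  simp only [Finset.mem_filter, Finset.mem_product, Finset.mem_range, and_iff_right_iff_imp]
  rintro ⟨-, -, -, -, -, h, -, h', -⟩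
  exact ⟨Nat.lt_succ_of_le (Nat.le_floor h), by omega⟩

lemma Rtrip.ne {g M : ℕ} {lam : ℝ} {s : ℕ → Fin 3 → ZMod M} {n x₁ x₂ x₃ : ℕ} {CM : Set (ZMod M)}
    (hs : GoodS M CM s) (h : Rtrip g M lam s n x₁ x₂ x₃) : x₁ ≠ x₂ ∧ x₁ ≠ x₃ ∧ x₂ ≠ x₃ := by
  obtain ⟨-, h01, h02, h12, -⟩ := hs n
  obtain ⟨-, -, -, -, -, -, -, -, -, -, e0, e1, e2⟩ := h
  refine ⟨?_, ?_, ?_⟩ <;> rintro rfl <;> simp_all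

/-- Residues mod `M` recover the ordered pair from the underlying set. -/
lemma injOn_admissiblePairs {g M : ℕ} {lam : ℝ} {s : ℕ → Fin 3 → ZMod M} {n : ℕ}
    {CM : Set (ZMod M)} (hs : GoodS M CM s) :
    Set.InjOn (fun p : ℕ × ℕ => ({p.1, p.2, n - p.1 - p.2} : Finset ℕ))
      (admissiblePairs g M lam s n) := by
  rintro ⟨a, b⟩ hp ⟨a', b'⟩ hq h
  dsimp only at h
  obtain ⟨-, h01, h02, h12, -⟩ := hs n
  obtain ⟨-, -, -, -, -, -, -, -, -, -, e0, e1, e2⟩ := mem_admissiblePairs.1 hp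
  obtain ⟨-, -, -, -, -, -, -, -, -, -, e0', e1', e2'⟩ := mem_admissiblePairs.1 hq
  have ha : a ∈ ({a', b', n - a' - b'} : Finset ℕ) := by
    rw [← h]; simp
  have hb : b ∈ ({a', b', n - a' - b'} : Finset ℕ) := by
    rw [← h]; simp
  simp only [Finset.mem_insert, Finset.mem_singleton] at ha hb
  have h1 : a = a' := by
    rcases ha with h | h | h
    · exact h
    · exact absurd (by rw [← e0, ← e1', h]) h01
    · exact absurd (by rw [← e0, ← e2', h]) h02
  have h2 : b = b' := by
    rcases hb with h | h | h
    · exact absurd (by rw [← e0', ← e1, h]) h01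
    · exact h
    · exact absurd (by rw [← e1, ← e2', h]) h12
  rw [h1, h2]

lemma tsum_Rn_eq_sum {g M : ℕ} {lam : ℝ} {s : ℕ → Fin 3 → ZMod M} {n : ℕ}
    {CM : Set (ZMod M)} (hs : GoodS M CM s) (f : ℕ → ℝ) :
    (∑' ω : ↥(Rn g M lam s n), ∏ y ∈ ω.1, f y) =
      ∑ p ∈ admissiblePairs g M lam s n, f p.1 * f p.2 * f (n - p.1 - p.2) := by
  have himg : Rn g M lam s n = ((admissiblePairs g M lam s n).image
      fun p : ℕ × ℕ => ({p.1, p.2, n - p.1 - p.2} : Finset ℕ) : Finset (Finset ℕ)) := by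
    ext ω
    simp only [Rn, Set.mem_ofPred_eq, Finset.coe_image, Set.mem_image, Finset.mem_coe]
    constructor
    · rintro ⟨x₁, x₂, x₃, rfl, h⟩
      have h3 : n - x₁ - x₂ = x₃ := by
        have := h.2.2.2.1
        omega
      exact ⟨(x₁, x₂), mem_admissiblePairs.2 (by simpa only [h3] using h), by simp only [h3]⟩
    · rintro ⟨p, hp, rfl⟩
      exact ⟨_, _, _, rfl, mem_admissiblePairs.1 hp⟩
  rw [himg, Finset.tsum_subtype' _ fun ω : Finset ℕ => ∏ y ∈ ω, f y,
    Finset.sum_image (injOn_admissiblePairs hs)]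
  refine Finset.sum_congr rfl fun p hp => ?_
  obtain ⟨h1, h2, h3⟩ := (mem_admissiblePairs.1 hp).ne hs
  rw [Finset.prod_insert (by simp [h1, h2]), Finset.prod_insert (by simp [h3]),
    Finset.prod_singleton, mul_assoc]

lemma card_admissiblePairs_le (g M : ℕ) (lam : ℝ) (s : ℕ → Fin 3 → ZMod M) (n : ℕ) (hn : 1 ≤ n)
    (hG : 1 ≤ glam g lam n) :
    ((admissiblePairs g M lam s n).card : ℝ) ≤ 4 * (glam g lam n * n) := by
  have h : (admissiblePairs g M lam s n).card ≤ (⌊glam g lam n⌋₊ + 1) * (n + 1) := by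
    unfold admissiblePairs
    classical
    refine (Finset.card_filter_le _ _).trans ?_
    simp
  have hfl : (⌊glam g lam n⌋₊ : ℝ) ≤ glam g lam n := Nat.floor_le (by linarith)
  have hn' : (1 : ℝ) ≤ n := by exact_mod_cast hn
  calc ((admissiblePairs g M lam s n).card : ℝ) ≤ (⌊glam g lam n⌋₊ + 1) * (n + 1) := by
        exact_mod_cast h
    _ ≤ (2 * glam g lam n) * (2 * n) := by gcongr <;> linarith
    _ = _ := by ring

lemma le_card_admissiblePairs (g M : ℕ) (hM : 1 ≤ M) (lam : ℝ) (s : ℕ → Fin 3 → ZMod M) (n : ℕ)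
    {CM : Set (ZMod M)} (hs : GoodS M CM s) (hMG : 4 * (M : ℝ) ≤ glam g lam n)
    (hGn : glam g lam n ≤ n / 4) :
    1 / (32 * (M : ℝ) ^ 2) * (glam g lam n * n) ≤ ((admissiblePairs g M lam s n).card : ℝ) := by
  have hM0 : (1 : ℝ) ≤ M := by exact_mod_cast hM
  obtain ⟨A, hA, hAc⟩ := exists_finset_residue_class M hM (s n 0) (glam g lam n / 2)
    (glam g lam n) (by linarith) (by linarith)
  obtain ⟨B, hB, hBc⟩ := exists_finset_residue_class M hM (s n 1) ((n : ℝ) / 4)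
    ((n : ℝ) / 2) (by positivity) (by linarith)
  have hsub : A ×ˢ B ⊆ admissiblePairs g M lam s n := by
    rintro ⟨a, b⟩ hab
    obtain ⟨ha, hb⟩ := Finset.mem_product.1 hab
    obtain ⟨ha1, ha2, ha3⟩ := hA a ha
    obtain ⟨hb1, hb2, hb3⟩ := hB b hb
    have hle : a + b ≤ n := by
      have : (a : ℝ) + b ≤ n := by linarith
      exact_mod_cast this
    obtain ⟨c, rfl⟩ := Nat.exists_eq_add_of_le hle
    have hc : a + b + c - a - b = c := by omega
    rw [mem_admissiblePairs]
    simp only [hc]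
    have hc4 : ((a + b + c : ℕ) : ℝ) / 4 ≤ c := by
      push_cast at *
      linarith
    have hres := (hs (a + b + c)).2.2.2.2
    refine ⟨?_, ?_, ?_, rfl, ha1, ha2, hb1, by omega, hc4, by omega, ha3, hb3, ?_⟩
    · have : (0 : ℝ) < a := by linarith
      exact_mod_cast this
    · have : (0 : ℝ) < b := by linarith
      exact_mod_cast this
    · have : (0 : ℝ) < c := by linarith
      exact_mod_cast this
    · rw [← ha3, ← hb3] at hres
      push_cast at hres ⊢
      simpa using hres.symm
  have hcard : (A.card : ℝ) * B.card ≤ (admissiblePairs g M lam s n).card := by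
    have := Finset.card_le_card hsub
    rw [Finset.card_product] at this
    exact_mod_cast this
  refine le_trans ?_ hcard
  calc _ = (glam g lam n - glam g lam n / 2) / (2 * M) * (((n : ℝ) / 2 - n / 4) / (2 * M)) := by
        field_simp
        ring
    _ ≤ _ := by
        refine mul_le_mul hAc hBc ?_ (by positivity)
        exact div_nonneg (by linarith) (by positivity)

lemma rpow_neg_div_le (x t c α : ℝ) (hx : 0 < x) (hc : 1 ≤ c) (hα : 0 ≤ α) (hα1 : α ≤ 1)
    (h : x / c ≤ t) : t ^ (-α) ≤ c * x ^ (-α) := by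
  have hc0 : 0 < c := by linarith
  calc t ^ (-α) ≤ (x / c) ^ (-α) :=
        Real.rpow_le_rpow_of_nonpos (by positivity) h (by linarith)
    _ = c ^ α * x ^ (-α) := by
        rw [Real.div_rpow hx.le hc0.le, Real.rpow_neg hc0.le, div_inv_eq_mul, mul_comm]
    _ ≤ c * x ^ (-α) := by
        gcongr
        simpa using Real.rpow_le_rpow_of_exponent_le hc hα1

theorem stmt6 (g M : ℕ) (hg : 2 ≤ g) (hM : 1 ≤ M) (CM : Set (ZMod M))
    (hSidon : IsSidonZ CM) (hcov : Covers3 CM) :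
    ∃ c C : ℝ, 0 < c ∧ 0 < C ∧
      ∀ s : ℕ → Fin 3 → ZMod M, GoodS M CM s →
      ∀ lam : ℝ, 1 < lam → ∃ n₀ : ℕ, ∀ n : ℕ, n₀ ≤ n →
        c * lam ^ (2 * g + 2) * Real.log n ≤
          (∑' ω : ↥(Rn g M lam s n), ∏ y ∈ ω.1, lam⁻¹ * (y : ℝ) ^ (-alph g)) ∧
        (∑' ω : ↥(Rn g M lam s n), ∏ y ∈ ω.1, lam⁻¹ * (y : ℝ) ^ (-alph g)) ≤
          C * lam ^ (2 * g + 2) * Real.log n := by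
  refine ⟨1 / (32 * (M : ℝ) ^ 2), 128, by positivity, by norm_num, fun s hs lam hlam => ?_⟩
  obtain ⟨n₀, hn₀⟩ := Filter.eventually_atTop.1 <|
    ((tendsto_glam_atTop g hg lam hlam).eventually_ge_atTop (4 * (M : ℝ))).and <|
      (eventually_glam_le g hg lam hlam).and (Filter.eventually_ge_atTop 1)
  refine ⟨n₀, fun n hn => ?_⟩
  obtain ⟨hMG, hGn, hn1⟩ := hn₀ n hn
  have hM0 : (1 : ℝ) ≤ M := by exact_mod_cast hM
  have hG1 : 1 ≤ glam g lam n := by linarith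
  have hG0 : 0 < glam g lam n := by linarith
  have hn0 : (0 : ℝ) < n := by exact_mod_cast hn1
  have hlam0 : 0 < lam := by linarith
  have hα := alph_pos g
  have hα1 := alph_le_one g
  rw [tsum_Rn_eq_sum hs fun y => lam⁻¹ * (y : ℝ) ^ (-alph g), mul_assoc, mul_assoc,
    ← main_term_eq g hg lam hlam n hn1 hG0]
  set T := lam⁻¹ ^ 3 *
    (glam g lam n ^ (-alph g) * ((n : ℝ) ^ (-alph g) * (n : ℝ) ^ (-alph g))) with hT
  have hT0 : 0 ≤ T := by positivity
  constructor
  · calc _ = 1 / (32 * (M : ℝ) ^ 2) * (glam g lam n * n) * T := by ring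
      _ ≤ (admissiblePairs g M lam s n).card * T := by
          gcongr
          exact le_card_admissiblePairs g M hM lam s n hs hMG hGn
      _ = (admissiblePairs g M lam s n).card • T := (nsmul_eq_mul _ _).symm
      _ ≤ _ := by
          refine Finset.card_nsmul_le_sum _ _ _ fun p hp => ?_
          obtain ⟨p1, p2, p3, -, -, u1, -, u2, -, u3, -⟩ := mem_admissiblePairs.1 hp
          have b1 := Real.rpow_le_rpow_of_nonpos (Nat.cast_pos.2 p1) u1 (neg_nonpos.2 hα.le)
          have b2 := Real.rpow_le_rpow_of_nonpos (Nat.cast_pos.2 p2)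
            (Nat.cast_le (α := ℝ).2 u2) (neg_nonpos.2 hα.le)
          have b3 := Real.rpow_le_rpow_of_nonpos (Nat.cast_pos.2 p3)
            (Nat.cast_le (α := ℝ).2 u3) (neg_nonpos.2 hα.le)
          calc T = lam⁻¹ * glam g lam n ^ (-alph g) * (lam⁻¹ * (n : ℝ) ^ (-alph g)) *
                (lam⁻¹ * (n : ℝ) ^ (-alph g)) := by rw [hT]; ring
            _ ≤ _ := by gcongr
  · calc _ ≤ (admissiblePairs g M lam s n).card • (32 * T) := by
          refine Finset.sum_le_card_nsmul _ _ _ fun p hp => ?_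
          obtain ⟨-, -, -, -, l1, -, l2, -, l3, -⟩ := mem_admissiblePairs.1 hp
          have b1 := rpow_neg_div_le _ _ _ _ hG0 (by norm_num) hα.le hα1 l1
          have b2 := rpow_neg_div_le _ _ _ _ hn0 (by norm_num) hα.le hα1 l2
          have b3 := rpow_neg_div_le _ _ _ _ hn0 (by norm_num) hα.le hα1 l3
          calc _ ≤ lam⁻¹ * (2 * glam g lam n ^ (-alph g)) *
                (lam⁻¹ * (4 * (n : ℝ) ^ (-alph g))) * (lam⁻¹ * (4 * (n : ℝ) ^ (-alph g))) := by
                gcongr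
            _ = 32 * T := by rw [hT]; ring
      _ = (admissiblePairs g M lam s n).card * (32 * T) := nsmul_eq_mul _ _
      _ ≤ 4 * (glam g lam n * n) * (32 * T) := by
          gcongr
          exact card_admissiblePairs_le g M lam s n hn1 hG1
      _ = _ := by ring
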